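/- Let π be a permutation of F_2^m with property (P1), and let σ be a permutation of F_2^m such that there is no (m−2)-dimensional subspace S of F_2^m with D_a D_b σ identically zero for all a, b ∈ S. Let h1, h2 : F_2^m → F_2 be arbitrary Boolean functions. Define functions on F_2^m × F_2^m by f1(x,y) = f2(x,y) = x·π(y) + h1(y) and f3(x,y) = f4(x,y) + 1 = y·σ(x) + h2(x). Then f = f1||f2||f3||f4 is a bent function in 2m+2 variables that has no (m+1)-dimensional M-subspace; i.e., f is bent and outside the completed Maiorana–McFarland class MM^#. -/

import Mathlib

open scoped BigOperators

/-- The vector space `F_2^n`. -/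
abbrev BV (n : ℕ) := Fin n → ZMod 2

/-- Dot product on `F_2^n`. -/
def dotp {n : ℕ} (x y : BV n) : ZMod 2 := ∑ i, x i * y i

/-- `W` is an M-subspace of `f` : all second-order derivatives of `f` in directions
from `W` vanish identically. -/
def IsMSub {M : Type} [AddCommGroup M] [Module (ZMod 2) M] (f : M → ZMod 2)
    (W : Submodule (ZMod 2) M) : Prop :=
  ∀ a ∈ W, ∀ b ∈ W, ∀ x, f x + f (x + a) + f (x + b) + f (x + a + b) = 0


/-- The bent 4-concatenation `f = f1 || f2 || f3 || f4`:
`f (x, y1, y2) = f1 x + y1 (f1 x + f3 x) + y2 (f1 x + f2 x)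
  + y1 y2 (f1 x + f2 x + f3 x + f4 x)`. -/
def concat {X : Type} (f1 f2 f3 f4 : X → ZMod 2) :
    X × (ZMod 2 × ZMod 2) → ZMod 2 :=
  fun p =>
    f1 p.1 + p.2.1 * (f1 p.1 + f3 p.1) + p.2.2 * (f1 p.1 + f2 p.1)
      + p.2.1 * p.2.2 * (f1 p.1 + f2 p.1 + f3 p.1 + f4 p.1)

/-- Property (P1): the second-order derivative `D_v D_w π` is not identically zero for
all linearly independent `v, w` (over `F_2` : `v ≠ 0`, `w ≠ 0`, `v ≠ w`). -/
def P1 {m : ℕ} (π : BV m → BV m) : Prop :=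
  ∀ v w : BV m, v ≠ 0 → w ≠ 0 → v ≠ w →
    ¬ ∀ x, π x + π (x + v) + π (x + w) + π (x + v + w) = 0

/-- Walsh–Hadamard transform of a function on `(F_2^m × F_2^m) × F_2 × F_2` at `a`. -/
def walshC2 {m : ℕ} (f : (BV m × BV m) × (ZMod 2 × ZMod 2) → ZMod 2)
    (a : (BV m × BV m) × (ZMod 2 × ZMod 2)) : ℤ :=
  ∑ p : (BV m × BV m) × (ZMod 2 × ZMod 2),
    (-1 : ℤ) ^ (f p + dotp a.1.1 p.1.1 + dotp a.1.2 p.1.2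
      + a.2.1 * p.2.1 + a.2.2 * p.2.2).val

/-- The sign `(-1)^z` attached to a bit `z`. -/
def bitSign (z : ZMod 2) : ℤ := (-1) ^ z.val

theorem bitSign_add (a b : ZMod 2) : bitSign (a + b) = bitSign a * bitSign b := by
  revert a b; decide

theorem bitSign_eq_or (a : ZMod 2) : bitSign a = 1 ∨ bitSign a = -1 := by
  revert a; decide

theorem dotp_comm {n : ℕ} (x y : BV n) : dotp x y = dotp y x := dotProduct_comm x y

theorem dotp_add {n : ℕ} (x y z : BV n) : dotp x (y + z) = dotp x y + dotp x z :=
  dotProduct_add x y z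

theorem add_dotp {n : ℕ} (x y z : BV n) : dotp (x + y) z = dotp x z + dotp y z :=
  add_dotProduct x y z

theorem zero_dotp {n : ℕ} (x : BV n) : dotp 0 x = 0 := zero_dotProduct x

theorem dotp_zero {n : ℕ} (x : BV n) : dotp x 0 = 0 := dotProduct_zero x

theorem single_dotp {n : ℕ} (i : Fin n) (c : BV n) : dotp (Pi.single i 1) c = c i :=
  single_one_dotProduct i c

theorem eq_zero_of_forall_dotp_eq_zero {n : ℕ} {c : BV n} (h : ∀ x, dotp x c = 0) : c = 0 := by
  funext i
  simpa [single_dotp] using h (Pi.single i 1)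

theorem add_eq_zero_iff_eq_bv {n : ℕ} (x y : BV n) : x + y = 0 ↔ x = y := by
  rw [add_eq_zero_iff_eq_neg, ZModModule.neg_eq_self]

/-- Orthogonality of the characters of `F_2^n`. -/
theorem sum_bitSign_dotp {n : ℕ} (c : BV n) :
    ∑ x : BV n, bitSign (dotp x c) = if c = 0 then 2 ^ n else 0 := by
  split_ifs with hc
  · subst hc
    simp [dotp_zero, bitSign, ZMod.card]
  · obtain ⟨i, hi⟩ := Function.ne_iff.mp hc
    have hi1 : c i = 1 := (by decide : ∀ z : ZMod 2, z ≠ 0 → z = 1) _ hi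
    have key : ∑ x : BV n, bitSign (dotp x c) = -∑ x : BV n, bitSign (dotp x c) := by
      rw [← Finset.sum_neg_distrib]
      refine Fintype.sum_equiv (Equiv.addRight (Pi.single i 1)) _ _ fun x => ?_
      simp [add_dotp, single_dotp, hi1, bitSign_add, show bitSign 1 = -1 from rfl]
    linarith

/-- The Walsh coefficients of a Maiorana–McFarland function are `±2^n`. -/
theorem walsh_maioranaMcFarland {n : ℕ} {π : BV n → BV n} (hπ : Function.Bijective π)
    (h : BV n → ZMod 2) (a b : BV n) :
    ∑ y : BV n, ∑ x : BV n, bitSign (dotp x (π y) + h y + dotp a x + dotp b y) = 2 ^ n ∨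
      ∑ y : BV n, ∑ x : BV n, bitSign (dotp x (π y) + h y + dotp a x + dotp b y) = -2 ^ n := by
  obtain ⟨y₀, rfl⟩ := hπ.2 a
  have inner : ∀ y : BV n, ∑ x : BV n, bitSign (dotp x (π y) + h y + dotp (π y₀) x + dotp b y) =
      if y = y₀ then bitSign (h y + dotp b y) * 2 ^ n else 0 := by
    intro y
    have split : ∀ x : BV n, bitSign (dotp x (π y) + h y + dotp (π y₀) x + dotp b y) =
        bitSign (h y + dotp b y) * bitSign (dotp x (π y + π y₀)) := by
      intro x
      rw [← bitSign_add, dotp_add, dotp_comm (π y₀) x]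
      congr 1
      ring
    simp only [split, ← Finset.mul_sum, sum_bitSign_dotp, add_eq_zero_iff_eq_bv, hπ.1.eq_iff,
      mul_ite, mul_zero]
  simp only [inner, Finset.sum_ite_eq', Finset.mem_univ, if_true]
  rcases bitSign_eq_or (h y₀ + dotp b y₀) with e | e <;> simp [e]

/-- If the derivative of `x·π(y) + h(y)` in two directions vanishes, then so does the derivative
of `π` in the corresponding `y`-directions. -/
theorem derivative_eq_zero_of_maioranaMcFarland {n : ℕ} {π : BV n → BV n} {h : BV n → ZMod 2}
    {a b c d : BV n}
    (H : ∀ x y, (dotp x (π y) + h y) + (dotp (x + a) (π (y + c)) + h (y + c)) +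
      (dotp (x + b) (π (y + d)) + h (y + d)) +
      (dotp (x + a + b) (π (y + c + d)) + h (y + c + d)) = 0) (y : BV n) :
    π y + π (y + c) + π (y + d) + π (y + c + d) = 0 := by
  refine eq_zero_of_forall_dotp_eq_zero fun x => ?_
  have H1 := H x y
  have H0 := H 0 y
  simp only [add_dotp, zero_dotp, dotp_add] at H1 H0 ⊢
  linear_combination H1 - H0

/-- Rank–nullity for the restriction of a linear map to a subspace. -/
theorem finrank_map_add_finrank_inf_ker {K M N : Type*} [Field K] [AddCommGroup M] [Module K M]
    [FiniteDimensional K M] [AddCommGroup N] [Module K N] (g : M →ₗ[K] N) (W : Submodule K M) :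
    Module.finrank K (W.map g) + Module.finrank K ↥(W ⊓ LinearMap.ker g) =
      Module.finrank K W := by
  rw [← LinearMap.finrank_range_add_finrank_ker (g.domRestrict W), LinearMap.range_domRestrict,
    LinearMap.ker_domRestrict, ← Submodule.map_comap_subtype,
    Submodule.finrank_map_subtype_eq]

/-- A subspace over `F_2` in which any two nonzero vectors coincide is at most one-dimensional. -/
theorem finrank_le_one_of_nonzero_eq {M : Type*} [AddCommGroup M] [Module (ZMod 2) M]
    {P : Submodule (ZMod 2) M} (h : ∀ u ∈ P, ∀ v ∈ P, u ≠ 0 → v ≠ 0 → u = v) :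
    Module.finrank (ZMod 2) P ≤ 1 := by
  by_cases hP : ∃ u ∈ P, u ≠ 0
  · obtain ⟨u, hu, hu0⟩ := hP
    refine finrank_le_one ⟨u, hu⟩ fun w => ?_
    by_cases hw : (w : M) = 0
    · exact ⟨0, by ext; simp [hw]⟩
    · exact ⟨1, by ext; simp [h u hu w w.2 hu0 hw]⟩
  · push Not at hP
    rw [(Submodule.eq_bot_iff P).mpr hP]
    simp

/-- Every subspace contains a subspace of any smaller dimension. -/
theorem exists_le_finrank_eq {K M : Type*} [Field K] [AddCommGroup M] [Module K M]
    [FiniteDimensional K M] (S : Submodule K M) {k : ℕ} (hk : k ≤ Module.finrank K S) :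
    ∃ T ≤ S, Module.finrank K T = k := by
  obtain ⟨v, hv⟩ := exists_linearIndependent_of_le_finrank hk
  refine ⟨(Submodule.span K (Set.range v)).map S.subtype, S.map_subtype_le _, ?_⟩
  rw [Submodule.finrank_map_subtype_eq, finrank_span_eq_card hv, Fintype.card_fin]

theorem stmt14 {m : ℕ} (π σ : BV m → BV m)
    (hπ : Function.Bijective π) (hσ : Function.Bijective σ) (hP1 : P1 π)
    (hσS : ¬ ∃ S : Submodule (ZMod 2) (BV m), Module.finrank (ZMod 2) ↥S = m - 2 ∧
      ∀ a ∈ S, ∀ b ∈ S, ∀ x, σ x + σ (x + a) + σ (x + b) + σ (x + a + b) = 0)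
    (h1 h2 : BV m → ZMod 2)
    (f1 f2 f3 f4 : BV m × BV m → ZMod 2)
    (hf1 : ∀ x y, f1 (x, y) = dotp x (π y) + h1 y)
    (hf2 : ∀ x y, f2 (x, y) = dotp x (π y) + h1 y)
    (hf3 : ∀ x y, f3 (x, y) = dotp y (σ x) + h2 x)
    (hf4 : ∀ x y, f4 (x, y) = dotp y (σ x) + h2 x + 1) :
    (∀ a, walshC2 (concat f1 f2 f3 f4) a = 2 ^ (m + 1) ∨
      walshC2 (concat f1 f2 f3 f4) a = -(2 ^ (m + 1))) ∧
    ¬ ∃ W : Submodule (ZMod 2) ((BV m × BV m) × (ZMod 2 × ZMod 2)),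
      Module.finrank (ZMod 2) ↥W = m + 1 ∧ IsMSub (concat f1 f2 f3 f4) W := by
  have hc : ∀ x y z w, concat f1 f2 f3 f4 ((x, y), (z, w)) =
      (1 + z) * (dotp x (π y) + h1 y) + z * (dotp y (σ x) + h2 x) + z * w := by
    intro x y z w
    have two : (2 : ZMod 2) = 0 := rfl
    simp only [concat, hf1, hf2, hf3, hf4]
    linear_combination
      (w * (dotp x (π y) + h1 y) + z * w * (dotp x (π y) + h1 y + dotp y (σ x) + h2 x)) * two
  refine ⟨?_, ?_⟩
  · rintro ⟨⟨a, b⟩, ⟨c, d⟩⟩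
    have zmod_sum : ∀ g : ZMod 2 → ℤ, ∑ z, g z = g 0 + g 1 := fun g => Fin.sum_univ_two g
    have expand : walshC2 (concat f1 f2 f3 f4) ((a, b), (c, d)) =
        (1 + bitSign d) *
          ∑ y : BV m, ∑ x : BV m, bitSign (dotp x (π y) + h1 y + dotp a x + dotp b y) +
        bitSign c * (1 - bitSign d) *
          ∑ x : BV m, ∑ y : BV m, bitSign (dotp y (σ x) + h2 x + dotp b y + dotp a x) := by
      rw [Finset.sum_comm]
      simp only [walshC2, Fintype.sum_prod_type, hc, Finset.mul_sum, ← Finset.sum_add_distrib,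
        zmod_sum]
      refine Finset.sum_congr rfl fun x _ => Finset.sum_congr rfl fun y _ => ?_
      change bitSign _ + bitSign _ + (bitSign _ + bitSign _) = _
      have two : (1 + 1 : ZMod 2) = 0 := rfl
      simp only [two, bitSign_add, mul_zero, mul_one, zero_mul, one_mul, add_zero, zero_add,
        show bitSign 1 = -1 from rfl]
      ring
    have hA := walsh_maioranaMcFarland hπ h1 a b
    have hB := walsh_maioranaMcFarland hσ h2 b a
    rw [expand]
    generalize (∑ y : BV m, ∑ x : BV m, bitSign (dotp x (π y) + h1 y + dotp a x + dotp b y)) = A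
      at hA ⊢
    generalize (∑ x : BV m, ∑ y : BV m, bitSign (dotp y (σ x) + h2 x + dotp b y + dotp a x)) = B
      at hB ⊢
    rcases bitSign_eq_or c with ec | ec <;> rcases bitSign_eq_or d with ed | ed <;>
      rcases hA with rfl | rfl <;> rcases hB with rfl | rfl <;> rw [ec, ed, pow_succ] <;>
      first
      | (left; ring1)
      | (right; ring1)
  · rintro ⟨W, hW, hM⟩
    let pX : (BV m × BV m) × (ZMod 2 × ZMod 2) →ₗ[ZMod 2] BV m :=
      LinearMap.fst _ _ _ ∘ₗ LinearMap.fst _ _ _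
    let pY : (BV m × BV m) × (ZMod 2 × ZMod 2) →ₗ[ZMod 2] BV m :=
      LinearMap.snd _ _ _ ∘ₗ LinearMap.fst _ _ _
    let pZ : (BV m × BV m) × (ZMod 2 × ZMod 2) →ₗ[ZMod 2] ZMod 2 :=
      LinearMap.fst _ _ _ ∘ₗ LinearMap.snd _ _ _
    let W₀ := W ⊓ LinearMap.ker pZ
    let W₁ := W₀ ⊓ LinearMap.ker pY
    have rankZ : Module.finrank (ZMod 2) (W.map pZ) ≤ 1 :=
      (Submodule.finrank_le _).trans (Module.finrank_self _).le
    have rankY : Module.finrank (ZMod 2) (W₀.map pY) ≤ 1 := by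
      apply finrank_le_one_of_nonzero_eq
      rintro _ ⟨⟨⟨a, c⟩, ⟨z, s⟩⟩, ⟨hu, hz⟩, rfl⟩ _ ⟨⟨⟨b, d⟩, ⟨z', t⟩⟩, ⟨hv, hz'⟩, rfl⟩ hc0 hd0
      obtain rfl : z = 0 := hz
      obtain rfl : z' = 0 := hz'
      by_contra hne
      refine hP1 c d hc0 hd0 hne
        (derivative_eq_zero_of_maioranaMcFarland (h := h1) (a := a) (b := b) fun x y => ?_)
      simpa [hc] using hM _ hu _ hv ((x, y), (0, 0))
    have rankW : Module.finrank (ZMod 2) ↥(W₁ ⊓ LinearMap.ker pX) ≤ 1 := by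
      apply finrank_le_one_of_nonzero_eq
      rintro ⟨⟨a, c⟩, ⟨z, s⟩⟩ ⟨⟨⟨-, hz⟩, hy⟩, hx⟩ ⟨⟨b, d⟩, ⟨z', t⟩⟩ ⟨⟨⟨-, hz'⟩, hy'⟩, hx'⟩ hu hv
      obtain rfl : z = 0 := hz
      obtain rfl : z' = 0 := hz'
      obtain rfl : c = 0 := hy
      obtain rfl : d = 0 := hy'
      obtain rfl : a = 0 := hx
      obtain rfl : b = 0 := hx'
      have one : ∀ r : ZMod 2, (((0 : BV m), (0 : BV m)), ((0 : ZMod 2), r)) ≠ 0 → r = 1 :=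
        fun r hr => (by decide : ∀ r : ZMod 2, r ≠ 0 → r = 1) r fun h => hr (by rw [h]; rfl)
      rw [one s hu, one t hv]
    have eqZ := finrank_map_add_finrank_inf_ker pZ W
    have eqY := finrank_map_add_finrank_inf_ker pY W₀
    have eqX := finrank_map_add_finrank_inf_ker pX W₁
    obtain ⟨S, hSle, hS⟩ := exists_le_finrank_eq (k := m - 2) (W₁.map pX)
      (by change _ + Module.finrank (ZMod 2) W₀ = _ at eqZ
          change _ + Module.finrank (ZMod 2) W₁ = _ at eqY
          omega)
    refine hσS ⟨S, hS, fun a ha b hb => ?_⟩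
    obtain ⟨⟨⟨a, c⟩, ⟨z, s⟩⟩, ⟨⟨hu, hz⟩, hy⟩, rfl⟩ := hSle ha
    obtain ⟨⟨⟨b, d⟩, ⟨z', t⟩⟩, ⟨⟨hv, hz'⟩, hy'⟩, rfl⟩ := hSle hb
    obtain rfl : z = 0 := hz
    obtain rfl : z' = 0 := hz'
    obtain rfl : c = 0 := hy
    obtain rfl : d = 0 := hy'
    refine derivative_eq_zero_of_maioranaMcFarland (h := h2) (a := 0) (b := 0) fun y x => ?_
    change (dotp y (σ x) + h2 x) + (dotp (y + 0) (σ (x + a)) + h2 (x + a)) +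
      (dotp (y + 0) (σ (x + b)) + h2 (x + b)) +
      (dotp (y + 0 + 0) (σ (x + a + b)) + h2 (x + a + b)) = 0
    have two : (1 + 1 : ZMod 2) = 0 := rfl
    have H := hM _ hu _ hv ((x, y), (1, 0))
    simp only [hc, Prod.mk_add_mk, add_zero, zero_add, two, zero_mul, one_mul] at H ⊢
    linear_combination H - (s + t) * two
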